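/- For every ε > 0 there exists a constant C₃ > 0 such that for all sufficiently large x, the number of positive integers n ≤ x with A₀(n) > n^{C₃} is at most 2εx + √x. -/

import Mathlib

open Polynomial Filter
open scoped Classical

/-- Height of an integer polynomial: max absolute value of coefficients. -/
def polyHeight (f : Polynomial ℤ) : ℕ := f.support.sup fun i => (f.coeff i).natAbs

/-- A(n): height of the n-th cyclotomic polynomial. -/
noncomputable def A (n : ℕ) : ℕ := polyHeight (Polynomial.cyclotomic n ℤ)

/-- B(n): max height over all integer polynomial divisors of x^n - 1. -/
noncomputable def B (n : ℕ) : ℕ :=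
  sSup {h : ℕ | ∃ f : Polynomial ℤ, f ∣ (Polynomial.X ^ n - 1) ∧ polyHeight f = h}

/-- A₀(n): max of A(d) over positive divisors d of n. -/
noncomputable def A0 (n : ℕ) : ℕ := n.divisors.sup A

/-- τ(n): number of positive divisors of n. -/
def tau (n : ℕ) : ℕ := n.divisors.card

/-- ω(n): number of distinct prime factors of n. -/
def omegaCount (n : ℕ) : ℕ := n.primeFactors.card

/-- p_k(n): the k-th largest distinct prime factor of n (1-indexed), or 1 if k > ω(n). -/
def pk (n k : ℕ) : ℕ :=
  if k ≤ n.primeFactors.card then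
    (n.primeFactors.sort (· ≤ ·)).getD (n.primeFactors.card - k) 1
  else 1

/-- ω([t,x],n): number of distinct prime factors of n lying in the real interval [t,x]. -/
noncomputable def omegaInterval (t x : ℝ) (n : ℕ) : ℕ :=
  (n.primeFactors.filter fun p : ℕ => t ≤ (p : ℝ) ∧ (p : ℝ) ≤ x).card

/-- rad(n): the radical (product of the distinct prime factors) of n. -/
def rad (n : ℕ) : ℕ := ∏ p ∈ n.primeFactors, p

/-! ### Mertens-type estimates -/

section Mertens

open ArithmeticFunction

lemma sum_vonMangoldt_mul_div (N : ℕ) :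
    ∑ n ∈ Finset.Ioc 0 N, vonMangoldt n * ((N / n : ℕ) : ℝ) = Real.log (N.factorial : ℝ) := by
  rw [← ArithmeticFunction.sum_Ioc_mul_zeta_eq_sum, vonMangoldt_mul_zeta]
  simp only [log_apply]
  induction N with
  | zero => simp
  | succ k ih =>
    rw [Finset.sum_Ioc_succ_top (Nat.zero_le k), ih, Nat.factorial_succ, Nat.cast_mul,
      Real.log_mul (by positivity) (by positivity), add_comm]

/-- Mertens' first theorem, for the von Mangoldt function. -/
lemma abs_sum_vonMangoldt_div_sub_log_le (N : ℕ) (hN : 1 ≤ N) :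
    |∑ n ∈ Finset.Ioc 0 N, vonMangoldt n / n - Real.log N| ≤ Real.log 4 + 4 := by
  have hN0 : (0 : ℝ) < N := by exact_mod_cast hN
  have key := sum_vonMangoldt_mul_div N
  have hlog4 : 0 ≤ Real.log 4 := Real.log_nonneg (by norm_num)
  have hpsi : ∑ n ∈ Finset.Ioc 0 N, vonMangoldt n ≤ (Real.log 4 + 4) * N := by
    have := Chebyshev.psi_le_const_mul_self (x := (N : ℝ)) hN0.le
    simpa [Chebyshev.psi] using this
  have hfac_le : Real.log (N.factorial : ℝ) ≤ N * Real.log N := by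
    rw [← Real.log_pow]
    exact Real.log_le_log (by positivity) (by exact_mod_cast Nat.factorial_le_pow N)
  have hfac_ge : N * Real.log N - N ≤ Real.log (N.factorial : ℝ) := by
    have h1 := Stirling.le_log_factorial_stirling (n := N) (by omega)
    have h2 : 0 ≤ Real.log N := Real.log_natCast_nonneg N
    have h3 : 0 ≤ Real.log (2 * Real.pi) :=
      Real.log_nonneg (by nlinarith [Real.pi_gt_three])
    linarith
  have hup : Real.log (N.factorial : ℝ) ≤ N * ∑ n ∈ Finset.Ioc 0 N, vonMangoldt n / n := by
    rw [← key, Finset.mul_sum]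
    refine Finset.sum_le_sum fun n _ => ?_
    calc vonMangoldt n * ((N / n : ℕ) : ℝ) ≤ vonMangoldt n * ((N : ℝ) / n) :=
          mul_le_mul_of_nonneg_left Nat.cast_div_le vonMangoldt_nonneg
      _ = N * (vonMangoldt n / n) := by ring
  have hlo : N * ∑ n ∈ Finset.Ioc 0 N, vonMangoldt n / n ≤
      Real.log (N.factorial : ℝ) + ∑ n ∈ Finset.Ioc 0 N, vonMangoldt n := by
    rw [← key, Finset.mul_sum, ← Finset.sum_add_distrib]
    refine Finset.sum_le_sum fun n hn => ?_
    have hn0 : 0 < n := (Finset.mem_Ioc.1 hn).1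
    have : (N : ℝ) / n ≤ ((N / n : ℕ) : ℝ) + 1 := by
      rw [← Nat.floor_div_eq_div (K := ℝ)]
      exact (Nat.lt_floor_add_one _).le
    calc N * (vonMangoldt n / n) = vonMangoldt n * ((N : ℝ) / n) := by ring
      _ ≤ vonMangoldt n * (((N / n : ℕ) : ℝ) + 1) :=
          mul_le_mul_of_nonneg_left this vonMangoldt_nonneg
      _ = _ := by ring
  rw [abs_le]
  constructor
  · refine le_of_mul_le_mul_left ?_ hN0
    nlinarith
  · refine le_of_mul_le_mul_left ?_ hN0
    nlinarith

/-- Partial summation against Mertens' first theorem: sums of `Λ n / n * b n` for a nonnegative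
antitone weight `b` are controlled by a discrete antiderivative of `b n` with respect to `log n`. -/
lemma sum_vonMangoldt_div_mul_le (b G : ℕ → ℝ) {m N : ℕ} (hm : 1 ≤ m) (hmN : m ≤ N)
    (hb0 : ∀ n, m ≤ n → 0 ≤ b n) (hb : ∀ n, m ≤ n → b (n + 1) ≤ b n)
    (hG : ∀ n, m ≤ n →
      (Real.log ((n + 1 : ℕ) : ℝ) - Real.log n) * b (n + 1) ≤ G (n + 1) - G n) :
    ∑ n ∈ Finset.Ioc m N, vonMangoldt n / n * b n ≤
      G N - G m + 2 * (Real.log 4 + 4) * b m := by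
  set F : ℕ → ℝ := fun n => ∑ k ∈ Finset.Ioc 0 n, vonMangoldt k / k - Real.log n with hF
  set C := Real.log 4 + 4 with hC
  have hFC : ∀ n, m ≤ n → |F n| ≤ C := fun n hn =>
    abs_sum_vonMangoldt_div_sub_log_le n (hm.trans hn)
  have hdiff : ∀ n, m ≤ n → |F n - F m| ≤ 2 * C := fun n hn => by
    have h1 := abs_le.1 (hFC n hn)
    have h2 := abs_le.1 (hFC m le_rfl)
    rw [abs_le]
    constructor <;> linarith
  have hind : ∑ n ∈ Finset.Ioc m N, vonMangoldt n / n * b n ≤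
      G N - G m + (F N - F m) * b N + 2 * C * (b m - b N) := by
    induction N, hmN using Nat.le_induction with
    | base => simp
    | succ n hn ih =>
      rw [Finset.sum_Ioc_succ_top hn]
      have hstep : vonMangoldt (n + 1) / ((n + 1 : ℕ) : ℝ) =
          F (n + 1) - F n + (Real.log ((n + 1 : ℕ) : ℝ) - Real.log n) := by
        simp only [hF]
        rw [Finset.sum_Ioc_succ_top (Nat.zero_le n)]
        ring
      have h1 := (abs_le.1 (hdiff n hn)).2
      have h2 := hG n hn
      have h3 := hb n hn
      rw [hstep]
      nlinarith [mul_nonneg (sub_nonneg.2 h1) (sub_nonneg.2 h3)]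
  have h1 := (abs_le.1 (hdiff N hmN)).2
  have h2 := hb0 N hmN
  nlinarith

/-- An upper bound in Mertens' second theorem, for sums over an interval. -/
lemma sum_prime_inv_le {m N : ℕ} (hm : 2 ≤ m) (hmN : m ≤ N) :
    ∑ p ∈ Finset.Ioc m N with p.Prime, (1 : ℝ) / p ≤
      Real.log (Real.log N) - Real.log (Real.log m) +
        2 * (Real.log 4 + 4) * (Real.log 2)⁻¹ := by
  have hpos : ∀ n : ℕ, m ≤ n → 0 < Real.log n := fun n hn =>
    Real.log_pos (by exact_mod_cast (by omega : 1 < n))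
  have hmono : ∀ n : ℕ, m ≤ n → Real.log n ≤ Real.log ((n + 1 : ℕ) : ℝ) := fun n hn =>
    Real.log_le_log (by exact_mod_cast (by omega : 0 < n)) (by exact_mod_cast Nat.le_succ n)
  have key := sum_vonMangoldt_div_mul_le (fun n => (Real.log n)⁻¹)
    (fun n => Real.log (Real.log n)) (by omega : 1 ≤ m) hmN
    (fun n hn => (inv_pos.2 (hpos n hn)).le)
    (fun n hn => inv_anti₀ (hpos n hn) (hmono n hn))
    (fun n hn => by
      have h0 := hpos n hn
      have h1 := hpos (n + 1) (by omega)
      have := Real.log_le_sub_one_of_pos (div_pos h0 h1)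
      rw [Real.log_div h0.ne' h1.ne'] at this
      have h2 : (Real.log ((n + 1 : ℕ) : ℝ) - Real.log n) * (Real.log ((n + 1 : ℕ) : ℝ))⁻¹ =
          1 - Real.log n / Real.log ((n + 1 : ℕ) : ℝ) := by field_simp
      rw [h2]
      linarith)
  have hlm : (Real.log m)⁻¹ ≤ (Real.log 2)⁻¹ :=
    inv_anti₀ (Real.log_pos (by norm_num))
      (Real.log_le_log (by norm_num) (by exact_mod_cast hm))
  have hlog4 : 0 ≤ Real.log 4 := Real.log_nonneg (by norm_num)
  calc ∑ p ∈ Finset.Ioc m N with p.Prime, (1 : ℝ) / p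
      = ∑ p ∈ Finset.Ioc m N with p.Prime, vonMangoldt p / p * (Real.log p)⁻¹ := by
        refine Finset.sum_congr rfl fun p hp => ?_
        rw [Finset.mem_filter, Finset.mem_Ioc] at hp
        rw [vonMangoldt_apply_prime hp.2]
        have := (hpos p hp.1.1.le).ne'
        field_simp
    _ ≤ ∑ p ∈ Finset.Ioc m N, vonMangoldt p / p * (Real.log p)⁻¹ :=
        Finset.sum_le_sum_of_subset_of_nonneg (Finset.filter_subset _ _) fun p hp _ =>
          mul_nonneg (div_nonneg vonMangoldt_nonneg (Nat.cast_nonneg p))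
            (Real.log_natCast_nonneg p |> inv_nonneg.2)
    _ ≤ _ := key
    _ ≤ _ := by gcongr

lemma exists_sum_prime_log_rpow_div_le {δ : ℝ} (hδ : 0 < δ) (hδ1 : δ ≤ 1) :
    ∃ K : ℝ, ∀ N : ℕ, 2 ≤ N →
      ∑ p ∈ Finset.Ioc 0 N with p.Prime, Real.log p ^ δ / p ≤ K * Real.log N ^ δ := by
  have hl2 : 0 < Real.log 2 := Real.log_pos (by norm_num)
  have hlog4 : 0 ≤ Real.log 4 := Real.log_nonneg (by norm_num)
  set D := Real.log 2 ^ δ / 2 + 2 * (Real.log 4 + 4) * Real.log 2 ^ (δ - 1) with hD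
  have hD0 : 0 ≤ D := by positivity
  refine ⟨D * (Real.log 2 ^ δ)⁻¹ + δ⁻¹, fun N hN => ?_⟩
  have hpos : ∀ n : ℕ, 2 ≤ n → 0 < Real.log n := fun n hn =>
    Real.log_pos (by exact_mod_cast (by omega : 1 < n))
  have hmono : ∀ n : ℕ, 2 ≤ n → Real.log n ≤ Real.log ((n + 1 : ℕ) : ℝ) := fun n hn =>
    Real.log_le_log (by exact_mod_cast (by omega : 0 < n)) (by exact_mod_cast Nat.le_succ n)
  have key := sum_vonMangoldt_div_mul_le (fun n => Real.log n ^ (δ - 1))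
    (fun n => δ⁻¹ * Real.log n ^ δ) (by norm_num : 1 ≤ 2) hN
    (fun n hn => (Real.rpow_pos_of_pos (hpos n hn) _).le)
    (fun n hn => Real.rpow_le_rpow_of_nonpos (hpos n hn) (hmono n hn) (by linarith))
    (fun n hn => by
      have h0 := hpos n hn
      have h1 := hpos (n + 1) (by omega)
      set u := Real.log n
      set v := Real.log ((n + 1 : ℕ) : ℝ)
      have hB := rpow_one_add_le_one_add_mul_self (s := u / v - 1)
        (by linarith [(div_pos h0 h1).le]) hδ.le hδ1
      rw [add_sub_cancel, Real.div_rpow h0.le h1.le, div_le_iff₀ (Real.rpow_pos_of_pos h1 δ)] at hB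
      have hv : v ^ (δ - 1) = v ^ δ / v := Real.rpow_sub_one h1.ne' δ
      show (v - u) * v ^ (δ - 1) ≤ δ⁻¹ * v ^ δ - δ⁻¹ * u ^ δ
      rw [hv, ← mul_sub, inv_mul_eq_div, le_div_iff₀ hδ]
      have : (v - u) * (v ^ δ / v) * δ = -(δ * (u / v - 1)) * v ^ δ := by
        field_simp
        ring
      rw [this]
      linarith)
  have hsplit : ∑ p ∈ Finset.Ioc 0 N with p.Prime, Real.log p ^ δ / p ≤
      Real.log 2 ^ δ / 2 +
        ∑ n ∈ Finset.Ioc 2 N, vonMangoldt n / n * Real.log n ^ (δ - 1) := by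
    have hsub : (Finset.Ioc 0 N).filter Nat.Prime ⊆
        insert 2 ((Finset.Ioc 2 N).filter Nat.Prime) := by
      intro p hp
      simp only [Finset.mem_filter, Finset.mem_Ioc, Finset.mem_insert] at hp ⊢
      have := hp.2.two_le
      rcases eq_or_ne p 2 with h | h
      · exact Or.inl h
      · exact Or.inr ⟨⟨by omega, hp.1.2⟩, hp.2⟩
    refine (Finset.sum_le_sum_of_subset_of_nonneg hsub fun p _ _ => by
      have := Real.log_natCast_nonneg p
      positivity).trans ?_
    rw [Finset.sum_insert (by simp)]
    refine add_le_add (by simp) ?_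
    calc ∑ p ∈ Finset.Ioc 2 N with p.Prime, Real.log p ^ δ / p
        = ∑ p ∈ Finset.Ioc 2 N with p.Prime, vonMangoldt p / p * Real.log p ^ (δ - 1) := by
          refine Finset.sum_congr rfl fun p hp => ?_
          rw [Finset.mem_filter, Finset.mem_Ioc] at hp
          have := (hpos p hp.1.1.le).ne'
          rw [vonMangoldt_apply_prime hp.2, Real.rpow_sub_one this]
          field_simp
      _ ≤ _ := Finset.sum_le_sum_of_subset_of_nonneg (Finset.filter_subset _ _) fun p hp _ =>
          mul_nonneg (div_nonneg vonMangoldt_nonneg (Nat.cast_nonneg p))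
            (Real.rpow_nonneg (Real.log_natCast_nonneg p) _)
  have hle : Real.log 2 ^ δ ≤ Real.log N ^ δ :=
    Real.rpow_le_rpow hl2.le (Real.log_le_log (by norm_num) (by exact_mod_cast hN)) hδ.le
  have h2δ : 0 < Real.log 2 ^ δ := Real.rpow_pos_of_pos hl2 δ
  have hDle : D ≤ D * (Real.log 2 ^ δ)⁻¹ * Real.log N ^ δ := by
    rw [mul_assoc]
    refine le_mul_of_one_le_right hD0 ?_
    rw [inv_mul_eq_div, one_le_div h2δ]
    exact hle
  have hneg : 0 ≤ δ⁻¹ * Real.log 2 ^ δ := by positivity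
  simp only [Nat.cast_ofNat] at key
  rw [add_mul]
  linarith

end Mertens

/-! ### Moments of weighted prime factor counts -/

/-- The number of prime factors of `n` exceeding `p`. -/
def largePrimeFactorCount (n p : ℕ) : ℕ := (n.primeFactors.filter fun q => p < q).card

lemma sum_pow_card_filter_dvd_le {c : ℝ} (hc : 0 ≤ c) (N : ℕ) (P : Finset ℕ)
    (hP : ∀ q ∈ P, q.Prime) {d : ℕ} (hd : ∀ q ∈ P, d.Coprime q) :
    ∑ n ∈ Finset.Ioc 0 N with d ∣ n, (1 + c) ^ (P.filter (· ∣ n)).card ≤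
      N / d * ∏ q ∈ P, (1 + c * (1 / q)) := by
  induction P using Finset.induction_on generalizing d with
  | empty =>
    simp only [Finset.filter_empty, Finset.card_empty, pow_zero, Finset.sum_const, nsmul_eq_mul,
      mul_one, Finset.prod_empty]
    rw [Nat.Ioc_filter_dvd_card_eq_div]
    exact Nat.cast_div_le
  | insert q P hq ih =>
    have hP' : ∀ r ∈ P, r.Prime := fun r hr => hP r (Finset.mem_insert_of_mem hr)
    have hqp := hP q (Finset.mem_insert_self q P)
    have hdq : d.Coprime q := hd q (Finset.mem_insert_self q P)
    have h1 := ih hP' (d := d) fun r hr => hd r (Finset.mem_insert_of_mem hr)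
    have h2 := ih hP' (d := d * q) fun r hr =>
      Nat.Coprime.mul_left (hd r (Finset.mem_insert_of_mem hr))
        ((Nat.coprime_primes hqp (hP' r hr)).2 fun h => hq (h ▸ hr))
    have hsplit : ∑ n ∈ Finset.Ioc 0 N with d ∣ n, (1 + c) ^ ((insert q P).filter (· ∣ n)).card =
        ∑ n ∈ Finset.Ioc 0 N with d ∣ n, (1 + c) ^ (P.filter (· ∣ n)).card +
        c * ∑ n ∈ Finset.Ioc 0 N with d * q ∣ n, (1 + c) ^ (P.filter (· ∣ n)).card := by
      rw [Finset.mul_sum, Finset.sum_filter, Finset.sum_filter, Finset.sum_filter,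
        ← Finset.sum_add_distrib]
      refine Finset.sum_congr rfl fun n _ => ?_
      have hiff : d * q ∣ n ↔ d ∣ n ∧ q ∣ n :=
        ⟨fun h => ⟨(dvd_mul_right d q).trans h, (dvd_mul_left q d).trans h⟩,
          fun h => hdq.mul_dvd_of_dvd_of_dvd h.1 h.2⟩
      rw [Finset.filter_insert]
      by_cases hdn : d ∣ n <;> by_cases hqn : q ∣ n
      · rw [if_pos hdn, if_pos hdn, if_pos hqn, if_pos (hiff.2 ⟨hdn, hqn⟩),
          Finset.card_insert_of_notMem (by simp [hq]), pow_succ]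
        ring
      all_goals simp [hiff, hdn, hqn]
    rw [hsplit, Finset.prod_insert hq]
    refine (add_le_add h1 (mul_le_mul_of_nonneg_left h2 hc)).trans_eq ?_
    have : (q : ℝ) ≠ 0 := by exact_mod_cast hqp.ne_zero
    push_cast
    rw [← div_div]
    ring

lemma largePrimeFactorCount_eq {n N p : ℕ} (hn : n ∈ Finset.Ioc 0 N) :
    largePrimeFactorCount n p = (((Finset.Ioc p N).filter Nat.Prime).filter (· ∣ n)).card := by
  rw [Finset.mem_Ioc] at hn
  unfold largePrimeFactorCount
  congr 1
  ext q
  simp only [Finset.mem_filter, Nat.mem_primeFactors, Finset.mem_Ioc]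
  constructor
  · rintro ⟨⟨h1, h2, h3⟩, h4⟩
    exact ⟨⟨⟨h4, (Nat.le_of_dvd hn.1 h2).trans hn.2⟩, h1⟩, h2⟩
  · rintro ⟨⟨⟨h4, h5⟩, h1⟩, h2⟩
    exact ⟨⟨h1, h2, by omega⟩, h4⟩

lemma exists_sum_pow_largePrimeFactorCount_le {c : ℝ} (hc : 0 ≤ c) :
    ∃ K : ℝ, 0 ≤ K ∧ ∀ N p : ℕ, p.Prime → p ≤ N →
      ∑ n ∈ Finset.Ioc 0 N with p ∣ n, (1 + c) ^ largePrimeFactorCount n p ≤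
        K * N / p * (Real.log N ^ c / Real.log p ^ c) := by
  refine ⟨Real.exp (c * (2 * (Real.log 4 + 4) * (Real.log 2)⁻¹)), (Real.exp_pos _).le,
    fun N p hp hpN => ?_⟩
  have hlp : 0 < Real.log p := Real.log_pos (by exact_mod_cast hp.one_lt)
  have hlN : 0 < Real.log N := Real.log_pos (by exact_mod_cast hp.one_lt.trans_le hpN)
  have h1 := sum_pow_card_filter_dvd_le hc N ((Finset.Ioc p N).filter Nat.Prime)
    (fun q hq => (Finset.mem_filter.1 hq).2) (d := p) (fun q hq => by
      simp only [Finset.mem_filter, Finset.mem_Ioc] at hq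
      exact (Nat.coprime_primes hp hq.2).2 hq.1.1.ne)
  have h2 : ∏ q ∈ (Finset.Ioc p N).filter Nat.Prime, (1 + c * (1 / (q : ℝ))) ≤
      Real.exp (c * (Real.log (Real.log N) - Real.log (Real.log p) +
        2 * (Real.log 4 + 4) * (Real.log 2)⁻¹)) := by
    calc ∏ q ∈ (Finset.Ioc p N).filter Nat.Prime, (1 + c * (1 / (q : ℝ)))
        ≤ ∏ q ∈ (Finset.Ioc p N).filter Nat.Prime, Real.exp (c * (1 / (q : ℝ))) :=
          Finset.prod_le_prod (fun q _ => by positivity) fun q _ => by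
            rw [add_comm]; exact Real.add_one_le_exp _
      _ = Real.exp (c * ∑ q ∈ (Finset.Ioc p N).filter Nat.Prime, (1 / (q : ℝ))) := by
          rw [Finset.mul_sum, Real.exp_sum]
      _ ≤ _ := Real.exp_le_exp.2
          (mul_le_mul_of_nonneg_left (sum_prime_inv_le hp.two_le hpN) hc)
  have h3 : Real.exp (c * (Real.log (Real.log N) - Real.log (Real.log p) +
        2 * (Real.log 4 + 4) * (Real.log 2)⁻¹)) =
      Real.exp (c * (2 * (Real.log 4 + 4) * (Real.log 2)⁻¹)) *
        (Real.log N ^ c / Real.log p ^ c) := by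
    rw [Real.rpow_def_of_pos hlN, Real.rpow_def_of_pos hlp, ← Real.exp_sub, ← Real.exp_add]
    congr 1
    ring
  calc ∑ n ∈ Finset.Ioc 0 N with p ∣ n, (1 + c) ^ largePrimeFactorCount n p
      = ∑ n ∈ Finset.Ioc 0 N with p ∣ n,
          (1 + c) ^ (((Finset.Ioc p N).filter Nat.Prime).filter (· ∣ n)).card :=
        Finset.sum_congr rfl fun n hn => by
          rw [largePrimeFactorCount_eq (Finset.mem_filter.1 hn).1]
    _ ≤ N / p * ∏ q ∈ (Finset.Ioc p N).filter Nat.Prime, (1 + c * (1 / (q : ℝ))) := h1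
    _ ≤ N / p * (Real.exp (c * (2 * (Real.log 4 + 4) * (Real.log 2)⁻¹)) *
        (Real.log N ^ c / Real.log p ^ c)) := by
        rw [← h3]
        exact mul_le_mul_of_nonneg_left h2 (by positivity)
    _ = _ := by ring

lemma exists_sum_sum_sqrt_log_mul_le :
    ∃ K : ℝ, 0 ≤ K ∧ ∀ N : ℕ, 2 ≤ N →
      ∑ n ∈ Finset.Ioc 0 N, ∑ p ∈ n.primeFactors,
        √(Real.log p * 2 ^ largePrimeFactorCount n p) ≤ K * N * √(Real.log N) := by
  have hs1 : 1 ≤ √2 := Real.one_le_sqrt.2 (by norm_num)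
  have hs2 : √2 < 3 / 2 := (Real.sqrt_lt' (by norm_num)).2 (by norm_num)
  set c := √2 - 1 with hc
  have hc0 : 0 ≤ c := by linarith
  obtain ⟨K₁, hK₁, h₁⟩ := exists_sum_pow_largePrimeFactorCount_le hc0
  obtain ⟨K₂, h₂⟩ := exists_sum_prime_log_rpow_div_le (δ := 1 / 2 - c) (by linarith) (by linarith)
  refine ⟨K₁ * |K₂|, by positivity, fun N hN => ?_⟩
  have hlN : 0 < Real.log N := Real.log_pos (by exact_mod_cast hN)
  have hsub : ∀ {y : ℝ}, 0 < y → y ^ (1 / 2 - c) = √y / y ^ c := fun hy => by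
    rw [Real.rpow_sub hy, Real.sqrt_eq_rpow]
  have hswap : ∑ n ∈ Finset.Ioc 0 N, ∑ p ∈ n.primeFactors,
        √(Real.log p * 2 ^ largePrimeFactorCount n p) =
      ∑ p ∈ Finset.Ioc 0 N with p.Prime, ∑ n ∈ Finset.Ioc 0 N with p ∣ n,
        √(Real.log p * 2 ^ largePrimeFactorCount n p) := by
    refine Finset.sum_comm' fun n p => ?_
    simp only [Finset.mem_filter, Finset.mem_Ioc, Nat.mem_primeFactors]
    constructor
    · rintro ⟨⟨h1, h2⟩, h3, h4, _⟩
      exact ⟨⟨⟨h1, h2⟩, h4⟩, ⟨h3.pos, (Nat.le_of_dvd h1 h4).trans h2⟩, h3⟩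
    · rintro ⟨⟨⟨h1, h2⟩, h4⟩, _, h3⟩
      exact ⟨⟨h1, h2⟩, h3, h4, by omega⟩
  have hterm : ∀ p ∈ (Finset.Ioc 0 N).filter Nat.Prime,
      ∑ n ∈ Finset.Ioc 0 N with p ∣ n, √(Real.log p * 2 ^ largePrimeFactorCount n p) ≤
        K₁ * N * Real.log N ^ c * (Real.log p ^ (1 / 2 - c) / p) := by
    intro p hp
    simp only [Finset.mem_filter, Finset.mem_Ioc] at hp
    have hlp : 0 < Real.log p := Real.log_pos (by exact_mod_cast hp.2.one_lt)
    calc ∑ n ∈ Finset.Ioc 0 N with p ∣ n, √(Real.log p * 2 ^ largePrimeFactorCount n p)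
        = √(Real.log p) *
          ∑ n ∈ Finset.Ioc 0 N with p ∣ n, (1 + c) ^ largePrimeFactorCount n p := by
          rw [Finset.mul_sum]
          refine Finset.sum_congr rfl fun n _ => ?_
          have hpow : ∀ k : ℕ, √((2 : ℝ) ^ k) = √2 ^ k := fun k => by
            rw [Real.sqrt_eq_iff_mul_self_eq (by positivity) (by positivity), ← mul_pow,
              Real.mul_self_sqrt (by norm_num)]
          rw [Real.sqrt_mul hlp.le, hc, add_sub_cancel, hpow]
      _ ≤ √(Real.log p) * (K₁ * N / p * (Real.log N ^ c / Real.log p ^ c)) :=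
          mul_le_mul_of_nonneg_left (h₁ N p hp.2 hp.1.2) (Real.sqrt_nonneg _)
      _ = _ := by
          rw [hsub hlp]
          ring
  rw [hswap]
  calc _ ≤ ∑ p ∈ Finset.Ioc 0 N with p.Prime,
        K₁ * N * Real.log N ^ c * (Real.log p ^ (1 / 2 - c) / p) := Finset.sum_le_sum hterm
    _ = K₁ * N * Real.log N ^ c *
        ∑ p ∈ Finset.Ioc 0 N with p.Prime, Real.log p ^ (1 / 2 - c) / p := by
        rw [Finset.mul_sum]
    _ ≤ K₁ * N * Real.log N ^ c * (|K₂| * Real.log N ^ (1 / 2 - c)) := by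
        refine mul_le_mul_of_nonneg_left ((h₂ N hN).trans ?_) (by positivity)
        exact mul_le_mul_of_nonneg_right (le_abs_self _) (by positivity)
    _ = _ := by
        rw [hsub hlN]
        have := (Real.rpow_pos_of_pos hlN c).ne'
        generalize Real.log N ^ c = y at *
        field_simp

/-! ### Heights of cyclotomic polynomials -/

lemma natAbs_coeff_le_polyHeight (f : Polynomial ℤ) (i : ℕ) :
    (f.coeff i).natAbs ≤ polyHeight f := by
  by_cases h : i ∈ f.support
  · exact Finset.le_sup (f := fun i => (f.coeff i).natAbs) h
  · simp [Polynomial.notMem_support_iff.1 h]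

lemma polyHeight_le_iff {f : Polynomial ℤ} {M : ℕ} :
    polyHeight f ≤ M ↔ ∀ i, |f.coeff i| ≤ (M : ℤ) := by
  constructor
  · intro h i
    rw [Int.abs_eq_natAbs]
    exact_mod_cast (natAbs_coeff_le_polyHeight f i).trans h
  · intro h
    refine Finset.sup_le fun i _ => ?_
    have := h i
    rw [Int.abs_eq_natAbs] at this
    exact_mod_cast this

lemma polyHeight_expand_le {p : ℕ} (hp : 0 < p) (f : Polynomial ℤ) :
    polyHeight (expand ℤ p f) ≤ polyHeight f := by
  refine Finset.sup_le fun i _ => ?_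
  rw [Polynomial.coeff_expand hp]
  split_ifs
  · exact natAbs_coeff_le_polyHeight f _
  · simp

lemma abs_coeff_coe_mul_le {f : Polynomial ℤ} {w : PowerSeries ℤ} {M M' t : ℕ}
    (hf : ∀ i, |f.coeff i| ≤ (M : ℤ)) (hw : ∀ i, |PowerSeries.coeff i w| ≤ (M' : ℤ))
    (ht : f.support.card ≤ t) (n : ℕ) :
    |PowerSeries.coeff n ((f : PowerSeries ℤ) * w)| ≤ ((t * (M * M') : ℕ) : ℤ) := by
  rw [PowerSeries.coeff_mul]
  have hsub : ∑ x ∈ Finset.HasAntidiagonal.antidiagonal n,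
      PowerSeries.coeff x.1 (f : PowerSeries ℤ) * PowerSeries.coeff x.2 w =
      ∑ x ∈ (Finset.HasAntidiagonal.antidiagonal n).filter (fun x => x.1 ∈ f.support),
        f.coeff x.1 * PowerSeries.coeff x.2 w := by
    rw [Finset.sum_filter]
    refine Finset.sum_congr rfl fun x _ => ?_
    rw [Polynomial.coeff_coe]
    split_ifs with h
    · rfl
    · rw [Polynomial.notMem_support_iff.1 h, zero_mul]
  rw [hsub]
  refine (Finset.abs_sum_le_sum_abs _ _).trans ?_
  have hcard : ((Finset.HasAntidiagonal.antidiagonal n).filter (fun x => x.1 ∈ f.support)).card ≤ t := by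
    refine le_trans (Finset.card_le_card_of_injOn Prod.fst
      (fun x hx => (Finset.mem_filter.1 hx).2) fun x hx y hy hxy => ?_) ht
    have h1 := Finset.HasAntidiagonal.mem_antidiagonal.1 (Finset.mem_filter.1 hx).1
    have h2 := Finset.HasAntidiagonal.mem_antidiagonal.1 (Finset.mem_filter.1 hy).1
    exact Prod.ext hxy (by omega)
  calc _ ≤ ∑ x ∈ (Finset.HasAntidiagonal.antidiagonal n).filter (fun x => x.1 ∈ f.support), ((M * M' : ℕ) : ℤ) := by
        refine Finset.sum_le_sum fun x _ => ?_
        rw [abs_mul]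
        push_cast
        exact mul_le_mul (hf _) (hw _) (abs_nonneg _) (Nat.cast_nonneg _)
    _ ≤ _ := by
        rw [Finset.sum_const, nsmul_eq_mul]
        push_cast
        gcongr

lemma coe_expand_eq {p : ℕ} (hp : p ≠ 0) (f : Polynomial ℤ) :
    ((expand ℤ p f : Polynomial ℤ) : PowerSeries ℤ) = PowerSeries.expand p hp (f : PowerSeries ℤ) := by
  ext n
  rw [Polynomial.coeff_coe, Polynomial.coeff_expand (Nat.pos_of_ne_zero hp),
    PowerSeries.coeff_expand, Polynomial.coeff_coe]

lemma card_support_cyclotomic_le {m : ℕ} (hm : 0 < m) :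
    (cyclotomic m ℤ).support.card ≤ 2 * m := by
  have h1 := Polynomial.card_supp_le_succ_natDegree (cyclotomic m ℤ)
  rw [natDegree_cyclotomic] at h1
  have := Nat.totient_le m
  omega

/-- The product of the elements `p` of `S`, each raised to the power `2 ^ k`, where `k` is the number
of elements of `S` exceeding `p`. -/
def dyadicPrimeProduct (S : Finset ℕ) : ℕ := ∏ p ∈ S, p ^ 2 ^ (S.filter fun q => p < q).card

lemma dyadicPrimeProduct_insert {a : ℕ} {S : Finset ℕ} (ha : ∀ p ∈ S, p < a) :
    dyadicPrimeProduct (insert a S) = a * dyadicPrimeProduct S ^ 2 := by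
  have haS : a ∉ S := fun h => lt_irrefl a (ha a h)
  unfold dyadicPrimeProduct
  rw [Finset.prod_insert haS, ← Finset.prod_pow]
  congr 1
  · have : (insert a S).filter (fun q => a < q) = ∅ := by
      refine Finset.filter_eq_empty_iff.2 fun q hq => ?_
      rcases Finset.mem_insert.1 hq with rfl | hq
      · exact lt_irrefl _
      · exact (ha q hq).le.not_gt
    simp [this]
  · refine Finset.prod_congr rfl fun p hp => ?_
    rw [Finset.filter_insert, if_pos (ha p hp), Finset.card_insert_of_notMem (by simp [haS]),
      pow_succ, pow_mul]

lemma dyadicPrimeProduct_pos {S : Finset ℕ} (hS : ∀ p ∈ S, p.Prime) :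
    0 < dyadicPrimeProduct S :=
  Finset.prod_pos fun p hp => pow_pos (hS p hp).pos _

lemma dyadicPrimeProduct_mono {S T : Finset ℕ} (hT : ∀ p ∈ T, p.Prime) (h : S ⊆ T) :
    dyadicPrimeProduct S ≤ dyadicPrimeProduct T := by
  calc dyadicPrimeProduct S ≤ ∏ p ∈ S, p ^ 2 ^ (T.filter fun q => p < q).card :=
        Finset.prod_le_prod' fun p hp => Nat.pow_le_pow_right (hT p (h hp)).pos
          (Nat.pow_le_pow_right (by norm_num) (Finset.card_le_card (Finset.filter_subset_filter _ h)))
    _ ≤ _ := Finset.prod_le_prod_of_subset_of_one_le' h fun p hp _ =>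
        Nat.one_le_pow _ _ (hT p hp).pos

/-- Simultaneous bound for the coefficients of a squarefree-index cyclotomic polynomial and of its
inverse power series. -/
lemma exists_inverse_cyclotomic_coeff_le (S : Finset ℕ) (hS : ∀ p ∈ S, p.Prime) :
    ∃ (M : ℕ) (u : PowerSeries ℤ),
      ((cyclotomic (∏ p ∈ S, p) ℤ : Polynomial ℤ) : PowerSeries ℤ) * u = 1 ∧
      (∀ i, |(cyclotomic (∏ p ∈ S, p) ℤ).coeff i| ≤ (M : ℤ)) ∧
      (∀ i, |PowerSeries.coeff i u| ≤ (M : ℤ)) ∧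
      (S = ∅ → M = 1) ∧
      (S.Nonempty → 2 * (∏ p ∈ S, p) * M ≤ dyadicPrimeProduct S ^ 3) := by
  induction S using Finset.induction_on_max with
  | empty =>
    refine ⟨1, -PowerSeries.mk 1, ?_, fun i => ?_, fun i => ?_, fun _ => rfl, fun h => by simp at h⟩
    · have := PowerSeries.mk_one_mul_one_sub_eq_one ℤ
      simp only [Finset.prod_empty, cyclotomic_one, Polynomial.coe_sub, Polynomial.coe_X,
        Polynomial.coe_one]
      linear_combination this
    · simp only [Finset.prod_empty, cyclotomic_one, Polynomial.coeff_sub, Polynomial.coeff_X,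
        Polynomial.coeff_one]
      split_ifs <;> simp_all
    · simp
  | insert a S ha ih =>
    have hS' : ∀ p ∈ S, p.Prime := fun p hp => hS p (Finset.mem_insert_of_mem hp)
    have hap : a.Prime := hS a (Finset.mem_insert_self a S)
    have haS : a ∉ S := fun h => lt_irrefl a (ha a h)
    obtain ⟨M, u, hu, hM, huM, hM1, hF⟩ := ih hS'
    rw [Finset.prod_insert haS, dyadicPrimeProduct_insert ha]
    set m := ∏ p ∈ S, p with hm
    have hm0 : 0 < m := Finset.prod_pos fun p hp => (hS' p hp).pos
    have hdvd : ¬ a ∣ m := fun h => by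
      obtain ⟨p, hp, hap'⟩ := (hap.prime.dvd_finsetProd_iff _).1 h
      exact haS ((Nat.prime_dvd_prime_iff_eq hap (hS' p hp)).1 hap' ▸ hp)
    have hexp : PowerSeries.expand a hap.ne_zero (cyclotomic m ℤ : PowerSeries ℤ) =
        (cyclotomic (a * m) ℤ : PowerSeries ℤ) * (cyclotomic m ℤ : PowerSeries ℤ) := by
      rw [← coe_expand_eq, cyclotomic_expand_eq_cyclotomic_mul hap hdvd, Polynomial.coe_mul,
        mul_comm m a]
    have hcyc : (cyclotomic (a * m) ℤ : PowerSeries ℤ) =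
        ((expand ℤ a (cyclotomic m ℤ) : Polynomial ℤ) : PowerSeries ℤ) * u := by
      rw [coe_expand_eq hap.ne_zero, hexp, mul_assoc, hu, mul_one]
    refine ⟨2 * m * (M * M),
      (cyclotomic m ℤ : PowerSeries ℤ) * PowerSeries.expand a hap.ne_zero u, ?_, ?_, ?_, ?_, ?_⟩
    · rw [← mul_assoc, ← hexp, ← map_mul, hu, map_one]
    · intro i
      rw [← Polynomial.coeff_coe, hcyc]
      refine abs_coeff_coe_mul_le (fun j => ?_) huM ?_ i
      · rw [Polynomial.coeff_expand hap.pos]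
        split_ifs
        · exact hM _
        · simp
      · refine le_trans (Finset.card_le_card fun j hj => ?_) ((Finset.card_image_le
          (s := (cyclotomic m ℤ).support) (f := (· * a))).trans (card_support_cyclotomic_le hm0))
        rw [Polynomial.mem_support_iff, Polynomial.coeff_expand hap.pos] at hj
        have hdj : a ∣ j := by
          by_contra h
          simp [h] at hj
        rw [if_pos hdj] at hj
        exact Finset.mem_image.2
          ⟨j / a, Polynomial.mem_support_iff.2 hj, Nat.div_mul_cancel hdj⟩
    · refine abs_coeff_coe_mul_le hM (fun j => ?_) (card_support_cyclotomic_le hm0)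
      rw [PowerSeries.coeff_expand]
      split_ifs
      · exact huM _
      · simp
    · simp
    · intro _
      rcases S.eq_empty_or_nonempty with rfl | hne
      · simp only [Finset.prod_empty] at hm
        rw [hM1 rfl, hm]
        simp only [dyadicPrimeProduct, Finset.prod_empty]
        have h4 : 2 ^ 2 ≤ a ^ 2 := Nat.pow_le_pow_left hap.two_le 2
        calc 2 * (a * 1) * (2 * 1 * (1 * 1)) = a * 2 ^ 2 := by ring
          _ ≤ a * a ^ 2 := Nat.mul_le_mul_left a h4
          _ = _ := by ring
      · have h := hF hne
        have ha1 : a ≤ a ^ 3 := Nat.le_self_pow (by norm_num) a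
        calc 2 * (a * m) * (2 * m * (M * M)) = a * (2 * m * M) ^ 2 := by ring
          _ ≤ a ^ 3 * (dyadicPrimeProduct S ^ 3) ^ 2 := by gcongr
          _ = _ := by ring

lemma A_le_dyadicPrimeProduct {n : ℕ} (hn : 0 < n) :
    A n ≤ dyadicPrimeProduct n.primeFactors ^ 3 := by
  induction n using Nat.strong_induction_on with
  | _ n ih =>
    by_cases hsq : Squarefree n
    · have hS : ∀ p ∈ n.primeFactors, p.Prime := fun p => Nat.prime_of_mem_primeFactors
      obtain ⟨M, u, -, hM, -, hM1, hF⟩ := exists_inverse_cyclotomic_coeff_le n.primeFactors hS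
      rw [Nat.prod_primeFactors_of_squarefree hsq] at hM hF
      refine (polyHeight_le_iff.2 hM).trans ?_
      rcases n.primeFactors.eq_empty_or_nonempty with h | h
      · rw [hM1 h]
        exact Nat.one_le_pow _ _ (dyadicPrimeProduct_pos hS)
      · exact (Nat.le_mul_of_pos_left M (by positivity)).trans (hF h)
    · obtain ⟨p, hp, hpn⟩ : ∃ p, p.Prime ∧ p * p ∣ n := by
        by_contra! h
        exact hsq (Nat.squarefree_iff_prime_squarefree.2 h)
      obtain ⟨k, rfl⟩ := hpn
      have hk : 0 < k := Nat.pos_of_ne_zero (by rintro rfl; simp at hn)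
      have hlt : p * k < p * p * k := by
        have := hp.one_lt
        nlinarith [mul_pos hp.pos hk]
      have hfac : (p * p * k).primeFactors = (p * k).primeFactors := by
        rw [Nat.primeFactors_mul (mul_ne_zero hp.ne_zero hp.ne_zero) hk.ne',
          Nat.primeFactors_mul hp.ne_zero hp.ne_zero, Finset.union_idempotent,
          Nat.primeFactors_mul hp.ne_zero hk.ne']
      have hle : A (p * p * k) ≤ A (p * k) := by
        unfold A
        rw [show p * p * k = p * k * p by ring,
          ← cyclotomic_expand_eq_cyclotomic hp (dvd_mul_right p k)]
        exact polyHeight_expand_le hp.pos _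
      rw [hfac]
      exact hle.trans (ih _ hlt (mul_pos hp.pos hk))

lemma A0_le_dyadicPrimeProduct (n : ℕ) : A0 n ≤ dyadicPrimeProduct n.primeFactors ^ 3 := by
  refine Finset.sup_le fun d hd => ?_
  obtain ⟨hdn, hn⟩ := Nat.mem_divisors.1 hd
  refine (A_le_dyadicPrimeProduct (Nat.pos_of_dvd_of_pos hdn (Nat.pos_of_ne_zero hn))).trans ?_
  exact Nat.pow_le_pow_left (dyadicPrimeProduct_mono
    (fun p => Nat.prime_of_mem_primeFactors) (Nat.primeFactors_mono hdn hn)) 3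

lemma log_dyadicPrimeProduct_primeFactors (n : ℕ) :
    Real.log (dyadicPrimeProduct n.primeFactors) =
      ∑ p ∈ n.primeFactors, Real.log p * 2 ^ largePrimeFactorCount n p := by
  unfold dyadicPrimeProduct largePrimeFactorCount
  push_cast
  rw [Real.log_prod fun p hp => pow_ne_zero _
    (by exact_mod_cast (Nat.prime_of_mem_primeFactors hp).ne_zero)]
  refine Finset.sum_congr rfl fun p _ => ?_
  rw [Real.log_pow, mul_comm]
  push_cast
  rfl

lemma sqrt_sum_le_sum_sqrt {ι : Type*} (s : Finset ι) {f : ι → ℝ} (hf : ∀ i ∈ s, 0 ≤ f i) :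
    √(∑ i ∈ s, f i) ≤ ∑ i ∈ s, √(f i) := by
  refine Real.sqrt_le_iff.2 ⟨Finset.sum_nonneg fun _ _ => Real.sqrt_nonneg _, ?_⟩
  calc ∑ i ∈ s, f i = ∑ i ∈ s, √(f i) ^ 2 :=
        Finset.sum_congr rfl fun i hi => (Real.sq_sqrt (hf i hi)).symm
    _ ≤ _ := Finset.sum_sq_le_sq_sum_of_nonneg fun _ _ => Real.sqrt_nonneg _

lemma mul_log_le_of_rpow_lt_A0 {C : ℝ} {n : ℕ} (hn : 0 < n) (h : (n : ℝ) ^ C < A0 n) :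
    C * Real.log n ≤
      3 * ∑ p ∈ n.primeFactors, Real.log p * 2 ^ largePrimeFactorCount n p := by
  have hn0 : (0 : ℝ) < n := by exact_mod_cast hn
  have hA : (A0 n : ℝ) ≤ (dyadicPrimeProduct n.primeFactors : ℝ) ^ 3 := by
    exact_mod_cast A0_le_dyadicPrimeProduct n
  have := Real.log_le_log (Real.rpow_pos_of_pos hn0 C) (h.le.trans hA)
  rw [Real.log_rpow hn0, Real.log_pow, log_dyadicPrimeProduct_primeFactors] at this
  exact_mod_cast this

/-- For every ε > 0 there is C₃ > 0 such that for all sufficiently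
large x, #{n ≤ x : A₀(n) > n^{C₃}} ≤ 2εx + √x. -/
theorem count_A0_large (ε : ℝ) (hε : 0 < ε) :
    ∃ C₃ : ℝ, 0 < C₃ ∧ ∀ᶠ x : ℝ in atTop,
      (((Finset.Icc 1 ⌊x⌋₊).filter
          (fun n => (A0 n : ℝ) > (n : ℝ) ^ C₃)).card : ℝ) ≤ 2 * ε * x + Real.sqrt x := by
  obtain ⟨K, hK, hsum⟩ := exists_sum_sum_sqrt_log_mul_le
  have hT : 0 < (K + 1) / ε := by positivity
  refine ⟨6 * ((K + 1) / ε) ^ 2, by positivity, ?_⟩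
  filter_upwards [eventually_ge_atTop (2 : ℝ)] with x hx
  have hx0 : 0 ≤ x := by linarith
  set T := (K + 1) / ε with hTdef
  set N := ⌊x⌋₊ with hN
  have hN2 : 2 ≤ N := Nat.le_floor (by exact_mod_cast hx)
  have hNx : (N : ℝ) ≤ x := Nat.floor_le hx0
  have hlN : 0 < Real.log N := Real.log_pos (by exact_mod_cast hN2)
  set bad := (Finset.Icc 1 N).filter (fun n => (A0 n : ℝ) > (n : ℝ) ^ (6 * T ^ 2)) with hbad
  have hsmall : ((bad.filter fun n : ℕ => (n : ℝ) ≤ √x).card : ℝ) ≤ √x := by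
    have hsub : bad.filter (fun n : ℕ => (n : ℝ) ≤ √x) ⊆ Finset.Icc 1 ⌊√x⌋₊ := fun n hn => by
      simp only [hbad, Finset.mem_filter, Finset.mem_Icc] at hn ⊢
      exact ⟨hn.1.1.1, Nat.le_floor hn.2⟩
    have := Finset.card_le_card hsub
    rw [Nat.card_Icc, Nat.add_sub_cancel] at this
    exact (Nat.cast_le.2 this).trans (Nat.floor_le (Real.sqrt_nonneg x))
  have hlarge : ((bad.filter fun n : ℕ => ¬ (n : ℝ) ≤ √x).card : ℝ) * (T * √(Real.log N)) ≤
      K * N * √(Real.log N) := by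
    rw [← nsmul_eq_mul]
    refine le_trans (Finset.card_nsmul_le_sum _ (fun n : ℕ => ∑ p ∈ n.primeFactors,
      √(Real.log p * 2 ^ largePrimeFactorCount n p)) _ fun n hn => ?_)
      ((Finset.sum_le_sum_of_subset_of_nonneg (fun n hn => ?_) fun n _ _ =>
        Finset.sum_nonneg fun _ _ => Real.sqrt_nonneg _).trans (hsum N hN2))
    · simp only [hbad, Finset.mem_filter, Finset.mem_Icc, not_le] at hn
      have hlog : Real.log N / 2 ≤ Real.log n := by
        have h1 : Real.log N ≤ Real.log x := Real.log_le_log (by positivity) hNx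
        have h2 : Real.log √x ≤ Real.log n :=
          Real.log_le_log (Real.sqrt_pos.2 (by linarith)) hn.2.le
        rw [Real.log_sqrt hx0] at h2
        linarith
      have hmul := mul_log_le_of_rpow_lt_A0 (by omega) hn.1.2
      have hle : T ^ 2 * Real.log N ≤
          ∑ p ∈ n.primeFactors, Real.log p * 2 ^ largePrimeFactorCount n p := by
        nlinarith [sq_nonneg T]
      refine le_trans ?_ (sqrt_sum_le_sum_sqrt _ fun p _ =>
        mul_nonneg (Real.log_natCast_nonneg p) (by positivity))
      rw [← Real.sqrt_sq hT.le, ← Real.sqrt_mul (sq_nonneg T)]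
      exact Real.sqrt_le_sqrt hle
    · simp only [hbad, Finset.mem_filter, Finset.mem_Icc] at hn
      exact Finset.mem_Ioc.2 ⟨hn.1.1.1, hn.1.1.2⟩
  have hlarge' : ((bad.filter fun n : ℕ => ¬ (n : ℝ) ≤ √x).card : ℝ) ≤ ε * x := by
    rw [← mul_assoc] at hlarge
    have h1 := le_of_mul_le_mul_right hlarge (Real.sqrt_pos.2 hlN)
    rw [hTdef, mul_div_assoc', div_le_iff₀ hε] at h1
    have h2 : K * (N : ℝ) * ε ≤ ε * x * (K + 1) := by
      nlinarith [mul_nonneg hK hε.le, mul_nonneg hε.le hx0]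
    exact le_of_mul_le_mul_right (h1.trans h2) (by linarith)
  have hcard : (bad.card : ℝ) = (bad.filter fun n : ℕ => (n : ℝ) ≤ √x).card +
      (bad.filter fun n : ℕ => ¬ (n : ℝ) ≤ √x).card := by
    exact_mod_cast (Finset.card_filter_add_card_filter_not _).symm
  rw [hcard]
  nlinarith [mul_nonneg hε.le hx0]
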